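/- arXiv:2412.02179 — 3 statements merged into one kernel-verified Lean document; each statement's English description precedes it below -/
import Mathlib

section
/- For every n ≥ 3, the cycle graph C_n satisfies Λ₁(C_n) = ∞, i.e. the supremum of λ₁(C_n, l) over all edge-length functions l on C_n normalized by Σ_{u ∈ V} m₀(u) = 1 is infinite. -/
open Finset Filter Topology
open scoped Classical ENNReal

noncomputable section

variable {V : Type*} [Fintype V]

/-- The set of neighbors of `u` as a `Finset`. -/
def nbr (G : SimpleGraph V) (u : V) : Finset V :=
  Finset.univ.filter (fun v => G.Adj u v)

/-- The vertex-weight `m₀(u) = ∑_{v ∼ u} l(uv)` induced by the edge-length function `l`. -/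
def m0 (G : SimpleGraph V) (l : V → V → ℝ) (u : V) : ℝ :=
  ∑ v ∈ nbr G u, l u v

/-- The Fujiwara Laplacian `(Δ_l φ)(u) = ∑_{v ∼ u} (m₁(uv)/m₀(u)) (φ(u) − φ(v))`,
where `m₁(uv) = 1/l(uv)`. -/
def lap (G : SimpleGraph V) (l : V → V → ℝ) (φ : V → ℝ) (u : V) : ℝ :=
  ∑ v ∈ nbr G u, ((1 / l u v) / m0 G l u) * (φ u - φ v)

/-- `l` is an edge-length function: symmetric and positive on adjacent pairs. -/
def IsLength (G : SimpleGraph V) (l : V → V → ℝ) : Prop :=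
  (∀ u v, l u v = l v u) ∧ ∀ u v, G.Adj u v → 0 < l u v

/-- The Dirichlet energy `∑_{uv ∈ E} m₁(uv) (φ(u) − φ(v))²`
(each edge counted once, via half the sum over ordered adjacent pairs). -/
def energy (G : SimpleGraph V) (l : V → V → ℝ) (φ : V → ℝ) : ℝ :=
  (1/2) * ∑ u, ∑ v ∈ nbr G u, (1 / l u v) * (φ u - φ v) ^ 2

/-- The squared norm `∑_{u ∈ V} m₀(u) φ(u)²`. -/
def mass (G : SimpleGraph V) (l : V → V → ℝ) (φ : V → ℝ) : ℝ :=
  ∑ u, m0 G l u * φ u ^ 2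

/-- The first nonzero eigenvalue of the Fujiwara Laplacian, via its variational
characterization as the infimum of the Rayleigh quotient over nonzero functions
orthogonal to the constants. -/
def lambda1 (G : SimpleGraph V) (l : V → V → ℝ) : ℝ :=
  sInf { r | ∃ φ : V → ℝ, φ ≠ 0 ∧ (∑ u, m0 G l u * φ u) = 0 ∧
    r = energy G l φ / mass G l φ }

/-- The largest eigenvalue of the Fujiwara Laplacian, via its variational
characterization as the supremum of the Rayleigh quotient. -/
def lambdaMax (G : SimpleGraph V) (l : V → V → ℝ) : ℝ :=
  sSup { r | ∃ φ : V → ℝ, φ ≠ 0 ∧ r = energy G l φ / mass G l φ }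

/-- `Λ₁(G)`: the supremum, in `[0, ∞]`, of `λ₁(G, l)` over all edge-length functions `l`
normalized by `∑_{u ∈ V} m₀(u) = 1`. -/
def Lambda1 (G : SimpleGraph V) : ℝ≥0∞ :=
  ⨆ (l : V → V → ℝ) (_ : IsLength G l ∧ (∑ u, m0 G l u) = 1),
    ENNReal.ofReal (lambda1 G l)

/-- `μ` is the nondecreasing sequence of eigenvalues (with multiplicity) of the
Fujiwara Laplacian `Δ_l`: it is monotone and admits a corresponding family of
eigenfunctions that is orthonormal for the inner product `⟨φ, ψ⟩ = ∑ m₀(u) φ(u) ψ(u)`. -/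
def IsLapEigSeq (G : SimpleGraph V) (l : V → V → ℝ)
    (μ : Fin (Fintype.card V) → ℝ) : Prop :=
  Monotone μ ∧ ∃ φ : Fin (Fintype.card V) → V → ℝ,
    (∀ i u, lap G l (φ i) u = μ i * φ i u) ∧
    (∀ i j, (∑ u, m0 G l u * φ i u * φ j u) = if i = j then 1 else 0)


lemma sq_sub_le_energy {G : SimpleGraph V} {l : V → V → ℝ} (hl : IsLength G l) (φ : V → ℝ)
    {u v : V} (huv : G.Adj u v) : (φ u - φ v) ^ 2 ≤ 2 * l u v * energy G l φ := by
  have hterm : ∀ x, ∀ y ∈ nbr G x, 0 ≤ (1 / l x y) * (φ x - φ y) ^ 2 := fun x y hy =>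
    mul_nonneg (one_div_nonneg.2 (hl.2 x y (by simpa [nbr] using hy)).le) (sq_nonneg _)
  have hle : (1 / l u v) * (φ u - φ v) ^ 2 ≤ 2 * energy G l φ :=
    calc (1 / l u v) * (φ u - φ v) ^ 2
        ≤ ∑ y ∈ nbr G u, (1 / l u y) * (φ u - φ y) ^ 2 :=
          single_le_sum (f := fun y => (1 / l u y) * (φ u - φ y) ^ 2) (hterm u)
            (by simpa [nbr] using huv)
      _ ≤ ∑ x, ∑ y ∈ nbr G x, (1 / l x y) * (φ x - φ y) ^ 2 :=
          single_le_sum (f := fun x => ∑ y ∈ nbr G x, (1 / l x y) * (φ x - φ y) ^ 2)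
            (fun x _ => sum_nonneg (hterm x)) (mem_univ u)
      _ = 2 * energy G l φ := by unfold energy; ring
  have hpos := hl.2 u v huv
  rw [one_div, inv_mul_le_iff₀ hpos] at hle
  linarith

lemma energy_nonneg {G : SimpleGraph V} {l : V → V → ℝ} (hl : IsLength G l) (φ : V → ℝ) :
    0 ≤ energy G l φ :=
  mul_nonneg (by norm_num) <| sum_nonneg fun x _ => sum_nonneg fun y hy =>
    mul_nonneg (one_div_nonneg.2 (hl.2 x y (by simpa [nbr] using hy)).le) (sq_nonneg _)

lemma m0_pos [Nontrivial V] {G : SimpleGraph V} (hG : G.Preconnected) {l : V → V → ℝ}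
    (hl : ∀ u v, G.Adj u v → 0 < l u v) (u : V) : 0 < m0 G l u := by
  obtain ⟨v, hv⟩ := (G.degree_pos_iff_exists_adj u).1 (hG.degree_pos_of_nontrivial u)
  exact sum_pos (fun y hy => hl u y (by simpa [nbr] using hy)) ⟨v, by simpa [nbr] using hv⟩

/-- If the energy controls the oscillation of every function around a vertex, then `λ₁` is
bounded below. -/
lemma one_div_le_lambda1 [Nontrivial V] {G : SimpleGraph V} (hG : G.Preconnected)
    {l : V → V → ℝ} (hl : IsLength G l) (hnorm : ∑ u, m0 G l u = 1) (o : V) {C : ℝ}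
    (hC : 0 < C) (hosc : ∀ φ : V → ℝ, ∀ u, (φ u - φ o) ^ 2 ≤ C * energy G l φ) :
    1 / C ≤ lambda1 G l := by
  have hpos := m0_pos hG hl.2
  refine le_csInf ?_ ?_
  · obtain ⟨v, hv⟩ := exists_ne o
    refine ⟨_, fun u => (if u = o then m0 G l v else 0) - (if u = v then m0 G l o else 0),
      fun h => ?_, ?_, rfl⟩
    · have := congrFun h o
      simp only [if_true, if_neg hv.symm, Pi.zero_apply, sub_zero] at this
      exact (hpos v).ne' this
    · simp [mul_sub, sum_sub_distrib, mul_comm]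
  · rintro _ ⟨φ, hφ, hmean, rfl⟩
    obtain ⟨w, hw⟩ := Function.ne_iff.1 hφ
    have hmass : 0 < mass G l φ :=
      sum_pos' (fun u _ => mul_nonneg (hpos u).le (sq_nonneg _))
        ⟨w, mem_univ w, mul_pos (hpos w) (sq_pos_of_ne_zero hw)⟩
    have hvar : ∑ u, m0 G l u * (φ u - φ o) ^ 2 = mass G l φ + φ o ^ 2 := by
      calc ∑ u, m0 G l u * (φ u - φ o) ^ 2
          = ∑ u, (m0 G l u * φ u ^ 2 - 2 * φ o * (m0 G l u * φ u) + φ o ^ 2 * m0 G l u) :=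
            sum_congr rfl fun u _ => by ring
        _ = mass G l φ + φ o ^ 2 := by
            rw [sum_add_distrib, sum_sub_distrib, ← mul_sum, ← mul_sum, hmean, hnorm, mass]
            ring
    have hbound : ∑ u, m0 G l u * (φ u - φ o) ^ 2 ≤ C * energy G l φ :=
      calc ∑ u, m0 G l u * (φ u - φ o) ^ 2
          ≤ ∑ u, m0 G l u * (C * energy G l φ) :=
            sum_le_sum fun u _ => mul_le_mul_of_nonneg_left (hosc φ u) (hpos u).le
        _ = C * energy G l φ := by rw [← sum_mul, hnorm, one_mul]
    rw [div_le_div_iff₀ hC hmass]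
    nlinarith [sq_nonneg (φ o)]

/-- A function on a path whose squared increments are at most `B` differs from its initial value by at
most `n * √B`. -/
lemma sq_sub_zero_le_of_sq_sub_succ_le {n : ℕ} (hn : 0 < n) (φ : Fin n → ℝ) {B : ℝ}
    (hB : 0 ≤ B)
    (h : ∀ (i : ℕ) (hi : i + 1 < n), (φ ⟨i + 1, hi⟩ - φ ⟨i, by lia⟩) ^ 2 ≤ B) (u : Fin n) :
    (φ u - φ ⟨0, hn⟩) ^ 2 ≤ (n : ℝ) ^ 2 * B := by
  have key : ∀ (i : ℕ) (hi : i < n), |φ ⟨i, hi⟩ - φ ⟨0, hn⟩| ≤ i * √B := by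
    intro i
    induction i with
    | zero => simp
    | succ i ih =>
      intro hi
      have := Real.abs_le_sqrt (h i hi)
      have := abs_sub_le (φ ⟨i + 1, hi⟩) (φ ⟨i, by lia⟩) (φ ⟨0, hn⟩)
      have := ih (by lia)
      push_cast
      linarith
  have hu : |φ u - φ ⟨0, hn⟩| ≤ n * √B :=
    (key u u.2).trans (mul_le_mul_of_nonneg_right (mod_cast u.2.le) (Real.sqrt_nonneg B))
  calc (φ u - φ ⟨0, hn⟩) ^ 2 = |φ u - φ ⟨0, hn⟩| ^ 2 := (sq_abs _).symm
    _ ≤ (n * √B) ^ 2 := pow_le_pow_left₀ (abs_nonneg _) hu 2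
    _ = (n : ℝ) ^ 2 * B := by rw [mul_pow, Real.sq_sqrt hB]

lemma m0_div (G : SimpleGraph V) (l : V → V → ℝ) (t : ℝ) (u : V) :
    m0 G (fun x y => l x y / t) u = m0 G l u / t :=
  (sum_div _ _ _).symm

/-- A normalized edge-length function on the cycle for which every edge except `{0, n - 1}` has
length at most `δ`. -/
lemma exists_isLength_cycleGraph {n : ℕ} (hn : 3 ≤ n) {δ : ℝ} (hδ : 0 < δ) :
    ∃ l : Fin n → Fin n → ℝ, IsLength (SimpleGraph.cycleGraph n) l ∧
      ∑ u, m0 (SimpleGraph.cycleGraph n) l u = 1 ∧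
      ∀ (i : ℕ) (hi : i + 1 < n), l ⟨i + 1, hi⟩ ⟨i, by lia⟩ ≤ δ := by
  have : Nontrivial (Fin n) := Fin.nontrivial_iff_two_le.2 (by lia)
  set a : Fin n := ⟨0, by lia⟩ with ha
  set b : Fin n := ⟨n - 1, by lia⟩ with hb
  have hab : (SimpleGraph.cycleGraph n).Adj a b := by
    rw [SimpleGraph.cycleGraph_adj', Fin.coe_sub_iff_lt.2 (Fin.mk_lt_mk.2 (by lia))]
    left
    change n + 0 - (n - 1) = 1
    lia
  let k : Fin n → Fin n → ℝ := fun u v => if u = a ∧ v = b ∨ u = b ∧ v = a then 1 else δ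
  have hk : ∀ u v, 0 < k u v := fun u v => by
    simp only [k]
    split_ifs <;> positivity
  have hm := m0_pos SimpleGraph.cycleGraph_preconnected fun u v
    (_ : (SimpleGraph.cycleGraph n).Adj u v) => hk u v
  set t := ∑ u, m0 (SimpleGraph.cycleGraph n) k u with ht
  have ht1 : 1 ≤ t :=
    calc (1 : ℝ) = k a b := by simp [k]
      _ ≤ m0 (SimpleGraph.cycleGraph n) k a :=
          single_le_sum (f := k a) (fun v _ => (hk a v).le) (by simpa [nbr] using hab)
      _ ≤ t := single_le_sum (fun u _ => (hm u).le) (mem_univ a)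
  have ht0 : 0 < t := by linarith
  refine ⟨fun u v => k u v / t, ⟨fun u v => ?_, fun u v _ => div_pos (hk u v) ht0⟩, ?_, ?_⟩
  · have : (u = a ∧ v = b ∨ u = b ∧ v = a) ↔ (v = a ∧ u = b ∨ v = b ∧ u = a) := by tauto
    simp only [k, this]
  · simp only [m0_div]
    rw [← sum_div, ← ht, div_self ht0.ne']
  · intro i hi
    have : k ⟨i + 1, hi⟩ ⟨i, by lia⟩ = δ := by
      simp only [k, ha, hb, Fin.mk.injEq]
      exact if_neg (by lia)
    simp only [this]
    exact div_le_self hδ.le ht1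

/-- For every `n ≥ 3`, the cycle graph `C_n` satisfies `Λ₁(C_n) = ∞`: the supremum of
`λ₁(C_n, l)` over all edge-length functions normalized by `∑_{u ∈ V} m₀(u) = 1`
is infinite. -/
theorem lambda1_sup_cycleGraph_eq_top (n : ℕ) (hn : 3 ≤ n) :
    Lambda1 (SimpleGraph.cycleGraph n) = ⊤ := by
  have : Nontrivial (Fin n) := Fin.nontrivial_iff_two_le.2 (by lia)
  refine ENNReal.eq_top_of_forall_nnreal_le fun r => ?_
  have hn0 : (0 : ℝ) < n := by exact_mod_cast (by lia : 0 < n)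
  have hr : (0 : ℝ) < r + 1 := by positivity
  set δ : ℝ := 1 / (2 * n ^ 2 * (r + 1)) with hδ
  have hδ0 : 0 < δ := by positivity
  obtain ⟨l, hl, hnorm, hsmall⟩ := exists_isLength_cycleGraph hn hδ0
  have hbound : 1 / ((n : ℝ) ^ 2 * (2 * δ)) ≤ lambda1 (SimpleGraph.cycleGraph n) l := by
    refine one_div_le_lambda1 SimpleGraph.cycleGraph_preconnected hl hnorm ⟨0, by lia⟩
      (by positivity) fun φ u => ?_
    have hE := energy_nonneg hl φ
    rw [mul_assoc]
    refine sq_sub_zero_le_of_sq_sub_succ_le (by lia) φ (by positivity) (fun i hi => ?_) u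
    have hadj : (SimpleGraph.cycleGraph n).Adj ⟨i + 1, hi⟩ ⟨i, by lia⟩ :=
      SimpleGraph.pathGraph_le_cycleGraph (SimpleGraph.pathGraph_adj.2 (Or.inr rfl))
    exact (sq_sub_le_energy hl φ hadj).trans
      (mul_le_mul_of_nonneg_right (by linarith [hsmall i hi]) hE)
  have hδr : 1 / ((n : ℝ) ^ 2 * (2 * δ)) = r + 1 := by
    rw [hδ]
    field_simp
  rw [← ENNReal.ofReal_coe_nnreal]
  exact (ENNReal.ofReal_le_ofReal (by linarith)).trans
    (le_iSup₂ (f := fun l' (_ : IsLength (SimpleGraph.cycleGraph n) l' ∧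
      ∑ u, m0 (SimpleGraph.cycleGraph n) l' u = 1) =>
        ENNReal.ofReal (lambda1 (SimpleGraph.cycleGraph n) l')) l ⟨hl, hnorm⟩)

end
end

section
/- Let G be a finite connected simple graph with vertices u₁, …, u_n and edge-length function l, and let G̃ be obtained from G by adding a new vertex u_{n+1} joined to u_n by a single edge; for t > 0 let l_t extend l by assigning length t to the new edge u_n u_{n+1}. Write 0 = λ₀ < λ₁ ≤ ⋯ ≤ λ_{n−1} for the eigenvalues of the Fujiwara Laplacian of (G, l) and 0 = λ̃₀(t) < λ̃₁(t) ≤ ⋯ ≤ λ̃_n(t) for those of (G̃, l_t), each counted with multiplicity. Then for every k with 0 ≤ k ≤ n−1, λ̃_k(t) → λ_k as t → 0⁺; in particular λ₁(G̃, l_t) → λ₁(G, l) as t → 0⁺. -/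
open Finset Filter Topology
open scoped Classical ENNReal

noncomputable section

variable {V : Type*} [Fintype V]

/-- The graph `G̃` obtained from `G` by adding a new pendant vertex (`none`) joined
to the vertex `x` by a single edge; the old vertices are embedded via `some`. -/
def addLeaf (G : SimpleGraph V) (x : V) : SimpleGraph (Option V) :=
  SimpleGraph.fromRel (fun a b =>
    (∃ u v, a = some u ∧ b = some v ∧ G.Adj u v) ∨ (a = some x ∧ b = none))

/-- The edge-length function on `G̃` extending `l`, where the new pendant edge is
given length `t`. -/
def extLen (l : V → V → ℝ) (t : ℝ) : Option V → Option V → ℝ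
  | some u, some v => l u v
  | _, _ => t

lemma mass_pos {G : SimpleGraph V} {l : V → V → ℝ} (hm : ∀ u, 0 < m0 G l u)
    {φ : V → ℝ} (hφ : φ ≠ 0) : 0 < mass G l φ := by
  obtain ⟨u, hu⟩ := Function.ne_iff.mp hφ
  exact Finset.sum_pos' (fun v _ => mul_nonneg (hm v).le (sq_nonneg _))
    ⟨u, Finset.mem_univ u, mul_pos (hm u) (sq_pos_of_ne_zero hu)⟩

/-- Green's formula: the Dirichlet energy is the quadratic form of the Laplacian. -/
lemma energy_eq_sum_lap {G : SimpleGraph V} {l : V → V → ℝ} (hl : IsLength G l)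
    (hm : ∀ u, 0 < m0 G l u) (φ : V → ℝ) :
    energy G l φ = ∑ u, m0 G l u * lap G l φ u * φ u := by
  have h₁ : ∑ u, m0 G l u * lap G l φ u * φ u =
      ∑ u, ∑ v, if G.Adj u v then 1 / l u v * (φ u - φ v) * φ u else 0 := by
    refine Finset.sum_congr rfl fun u _ => ?_
    rw [lap, Finset.mul_sum, Finset.sum_mul, nbr, Finset.sum_filter]
    refine Finset.sum_congr rfl fun v _ => ?_
    split_ifs
    · have := (hm u).ne'
      field_simp
    · rfl
  have h₂ : ∑ u, m0 G l u * lap G l φ u * φ u =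
      ∑ u, ∑ v, if G.Adj u v then 1 / l u v * (φ v - φ u) * φ v else 0 := by
    rw [h₁, Finset.sum_comm]
    refine Finset.sum_congr rfl fun u _ => Finset.sum_congr rfl fun v _ => ?_
    rw [hl.1 u v]
    simp only [G.adj_comm]
  have h₃ : energy G l φ = (1 / 2) * (∑ u, m0 G l u * lap G l φ u * φ u +
      ∑ u, m0 G l u * lap G l φ u * φ u) := by
    nth_rewrite 1 [h₁]
    rw [h₂, ← Finset.sum_add_distrib, energy]
    congr 1
    refine Finset.sum_congr rfl fun u _ => ?_
    rw [← Finset.sum_add_distrib, nbr, Finset.sum_filter]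
    refine Finset.sum_congr rfl fun v _ => ?_
    split_ifs
    · ring
    · simp
  linarith

lemma lap_sum_smul (G : SimpleGraph V) (l : V → V → ℝ) {ι : Type*} [Fintype ι]
    (φ : ι → V → ℝ) (a : ι → ℝ) (u : V) :
    lap G l (∑ i, a i • φ i) u = ∑ i, a i * lap G l (φ i) u := by
  simp only [lap, Finset.sum_apply, Pi.smul_apply, smul_eq_mul, Finset.mul_sum]
  rw [Finset.sum_comm]
  refine Finset.sum_congr rfl fun v _ => ?_
  rw [← Finset.sum_sub_distrib, Finset.mul_sum]
  refine Finset.sum_congr rfl fun i _ => ?_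
  ring

/-- The family `φ` is orthonormal for the inner product weighted by `m₀`. -/
def IsM0Orthonormal (G : SimpleGraph V) (l : V → V → ℝ) {ι : Type*} (φ : ι → V → ℝ) : Prop :=
  ∀ i j, (∑ u, m0 G l u * φ i u * φ j u) = if i = j then 1 else 0

section Orthonormal

variable {G : SimpleGraph V} {l : V → V → ℝ} {ι : Type*} [Fintype ι] {φ : ι → V → ℝ}

lemma IsM0Orthonormal.inner_sum_smul (h : IsM0Orthonormal G l φ) (a : ι → ℝ) (j : ι) :
    ∑ u, m0 G l u * (∑ i, a i • φ i) u * φ j u = a j := by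
  have : ∀ u, m0 G l u * (∑ i, a i • φ i) u * φ j u =
      ∑ i, a i * (m0 G l u * φ i u * φ j u) := by
    intro u
    simp only [Finset.sum_apply, Pi.smul_apply, smul_eq_mul, Finset.mul_sum, Finset.sum_mul]
    refine Finset.sum_congr rfl fun i _ => ?_
    ring
  simp only [this]
  rw [Finset.sum_comm]
  simp only [← Finset.mul_sum, h _ j]
  simp

lemma IsM0Orthonormal.inner_sum_smul_sum_smul (h : IsM0Orthonormal G l φ) (a b : ι → ℝ) :
    ∑ u, m0 G l u * (∑ i, a i • φ i) u * (∑ i, b i • φ i) u = ∑ i, a i * b i := by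
  have : ∀ u, m0 G l u * (∑ i, a i • φ i) u * (∑ i, b i • φ i) u =
      ∑ j, b j * (m0 G l u * (∑ i, a i • φ i) u * φ j u) := by
    intro u
    rw [Finset.sum_apply u _ fun i => b i • φ i, Finset.mul_sum]
    refine Finset.sum_congr rfl fun j _ => ?_
    rw [Pi.smul_apply, smul_eq_mul]
    ring
  simp only [this]
  rw [Finset.sum_comm]
  simp only [← Finset.mul_sum, h.inner_sum_smul]
  exact Finset.sum_congr rfl fun j _ => mul_comm _ _

lemma IsM0Orthonormal.mass_sum_smul (h : IsM0Orthonormal G l φ) (a : ι → ℝ) :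
    mass G l (∑ i, a i • φ i) = ∑ i, a i ^ 2 := by
  simp only [sq, ← h.inner_sum_smul_sum_smul, mass, mul_assoc]

lemma IsM0Orthonormal.energy_sum_smul (h : IsM0Orthonormal G l φ) (hl : IsLength G l)
    (hm : ∀ u, 0 < m0 G l u) {μ : ι → ℝ} (hμ : ∀ i u, lap G l (φ i) u = μ i * φ i u)
    (a : ι → ℝ) : energy G l (∑ i, a i • φ i) = ∑ i, μ i * a i ^ 2 := by
  have hlap : ∀ u, lap G l (∑ i, a i • φ i) u = (∑ i, (μ i * a i) • φ i) u := by
    intro u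
    rw [lap_sum_smul, Finset.sum_apply]
    refine Finset.sum_congr rfl fun i _ => ?_
    rw [hμ, Pi.smul_apply, smul_eq_mul]
    ring
  rw [energy_eq_sum_lap hl hm]
  simp only [hlap]
  rw [h.inner_sum_smul_sum_smul]
  exact Finset.sum_congr rfl fun i _ => by ring

lemma IsM0Orthonormal.linearIndependent (h : IsM0Orthonormal G l φ) :
    LinearIndependent ℝ φ := by
  rw [Fintype.linearIndependent_iff]
  intro a ha j
  rw [← h.inner_sum_smul a j, ha]
  simp

lemma IsM0Orthonormal.exists_eq_sum_smul (h : IsM0Orthonormal G l φ)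
    (hcard : Fintype.card ι = Fintype.card V) (ψ : V → ℝ) :
    ∃ a : ι → ℝ, ψ = ∑ i, a i • φ i := by
  have hspan := h.linearIndependent.span_eq_top_of_card_eq_finrank' (by simp [hcard])
  obtain ⟨a, ha⟩ := (Submodule.mem_span_range_iff_exists_fun ℝ).mp
    (hspan ▸ Submodule.mem_top : ψ ∈ Submodule.span ℝ (Set.range φ))
  exact ⟨a, ha.symm⟩

end Orthonormal

section MinMax

variable {G : SimpleGraph V} {l : V → V → ℝ} {μ : Fin (Fintype.card V) → ℝ}

lemma IsLapEigSeq.exists_orthonormal (h : IsLapEigSeq G l μ) :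
    ∃ φ : Fin (Fintype.card V) → V → ℝ,
      (∀ i u, lap G l (φ i) u = μ i * φ i u) ∧ IsM0Orthonormal G l φ := by
  obtain ⟨-, φ, hφ, ho⟩ := h
  exact ⟨φ, hφ, fun i j => (ho i j).trans (by congr)⟩

lemma IsLapEigSeq.nonneg (h : IsLapEigSeq G l μ) (hl : IsLength G l)
    (hm : ∀ u, 0 < m0 G l u) (k : Fin (Fintype.card V)) : 0 ≤ μ k := by
  obtain ⟨φ, hφ, ho⟩ := h.exists_orthonormal
  have he := ho.energy_sum_smul hl hm hφ (Pi.single k 1)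
  have hs : ∑ i, μ i * (Pi.single k 1 : Fin (Fintype.card V) → ℝ) i ^ 2 = μ k := by
    rw [Finset.sum_eq_single k (fun i _ hi => by simp [hi]) (by simp)]
    simp
  rw [← hs, ← he]
  exact energy_nonneg hl _

/-- The first `k + 1` eigenfunctions span a space on which the Rayleigh quotient is at
most `μ k`. -/
lemma IsLapEigSeq.exists_energy_le (h : IsLapEigSeq G l μ) (hl : IsLength G l)
    (hm : ∀ u, 0 < m0 G l u) (k : Fin (Fintype.card V)) :
    ∃ T : (Fin (k.val + 1) → ℝ) →ₗ[ℝ] (V → ℝ), Function.Injective T ∧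
      ∀ c, energy G l (T c) ≤ μ k * mass G l (T c) := by
  have hmono := h.1
  obtain ⟨φ, hφ, ho⟩ := h.exists_orthonormal
  let e : Fin (k.val + 1) → Fin (Fintype.card V) := Fin.castLE k.isLt
  have he : Function.Injective e := Fin.castLE_injective _
  have ho' : IsM0Orthonormal G l (φ ∘ e) := fun i j => by simp [ho (e i) (e j), he.eq_iff]
  refine ⟨Fintype.linearCombination ℝ (φ ∘ e),
    linearIndependent_iff_injective_fintypeLinearCombination.mp ho'.linearIndependent, fun c => ?_⟩
  rw [Fintype.linearCombination_apply, ho'.mass_sum_smul,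
    ho'.energy_sum_smul hl hm (μ := μ ∘ e) (fun i u => hφ _ u), Finset.mul_sum]
  refine Finset.sum_le_sum fun i _ => mul_le_mul_of_nonneg_right (hmono ?_) (sq_nonneg _)
  exact Fin.le_def.mpr (Nat.lt_succ_iff.mp i.isLt)

/-- Courant–Fischer upper bound: if the Rayleigh quotient is at most `C` on a space of
dimension greater than `k`, then `μ k ≤ C`. -/
lemma IsLapEigSeq.le_of_energy_le (h : IsLapEigSeq G l μ) (hl : IsLength G l)
    (hm : ∀ u, 0 < m0 G l u) (k : Fin (Fintype.card V)) {C : ℝ}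
    (T : (Fin (k.val + 1) → ℝ) →ₗ[ℝ] (V → ℝ)) (hT : Function.Injective T)
    (hC : ∀ c, energy G l (T c) ≤ C * mass G l (T c)) : μ k ≤ C := by
  have hmono := h.1
  obtain ⟨φ, hφ, ho⟩ := h.exists_orthonormal
  let B : (V → ℝ) →ₗ[ℝ] (Fin k.val → ℝ) :=
    { toFun := fun ψ j => ∑ u, m0 G l u * ψ u * φ (Fin.castLE k.isLt.le j) u
      map_add' := fun ψ χ => by
        ext j
        simp only [Pi.add_apply, ← Finset.sum_add_distrib]
        exact Finset.sum_congr rfl fun u _ => by ring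
      map_smul' := fun r ψ => by
        ext j
        simp only [Pi.smul_apply, smul_eq_mul, RingHom.id_apply, Finset.mul_sum]
        exact Finset.sum_congr rfl fun u _ => by ring }
  have hker : LinearMap.ker (B ∘ₗ T) ≠ ⊥ := LinearMap.ker_ne_bot_of_finrank_lt (by simp)
  obtain ⟨c, hc, hc0⟩ := (Submodule.ne_bot_iff _).mp hker
  obtain ⟨a, ha⟩ := ho.exists_eq_sum_smul (by simp) (T c)
  have ha0 : ∀ i, i < k → a i = 0 := fun i hi => by
    have := congrFun (LinearMap.mem_ker.mp hc) ⟨i, hi⟩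
    rw [← ho.inner_sum_smul a i, ← ha]
    exact this
  have hTc : T c ≠ 0 := fun h0 => hc0 (hT (by rw [h0, map_zero]))
  have hle : μ k * mass G l (T c) ≤ energy G l (T c) := by
    rw [ha, ho.mass_sum_smul, ho.energy_sum_smul hl hm hφ, Finset.mul_sum]
    refine Finset.sum_le_sum fun i _ => ?_
    rcases lt_or_ge i k with hi | hi
    · simp [ha0 i hi]
    · exact mul_le_mul_of_nonneg_right (hmono hi) (sq_nonneg _)
  exact le_of_mul_le_mul_right (hle.trans (hC c)) (mass_pos hm hTc)

/-- The variational `λ₁` is the second entry of the eigenvalue sequence. -/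
lemma IsLapEigSeq.lambda1_eq (h : IsLapEigSeq G l μ) (hl : IsLength G l)
    (hm : ∀ u, 0 < m0 G l u) (h1 : 1 < Fintype.card V) : lambda1 G l = μ ⟨1, h1⟩ := by
  have hlower : ∀ ψ : V → ℝ, ψ ≠ 0 → ∑ u, m0 G l u * ψ u = 0 →
      μ ⟨1, h1⟩ ≤ energy G l ψ / mass G l ψ := by
    intro ψ hψ hψ0
    have hpos := mass_pos hm hψ
    have hone : 0 < mass G l (1 : V → ℝ) := by
      obtain ⟨u, -⟩ := Function.ne_iff.mp hψ
      exact mass_pos hm fun h0 => one_ne_zero (congrFun h0 u)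
    have hmass : ∀ a b : ℝ, mass G l (a • (1 : V → ℝ) + b • ψ) =
        a ^ 2 * mass G l (1 : V → ℝ) + b ^ 2 * mass G l ψ := by
      intro a b
      have : mass G l (a • (1 : V → ℝ) + b • ψ) = a ^ 2 * mass G l (1 : V → ℝ) +
          b ^ 2 * mass G l ψ + 2 * a * b * ∑ u, m0 G l u * ψ u := by
        simp only [mass, Finset.mul_sum, ← Finset.sum_add_distrib]
        refine Finset.sum_congr rfl fun u _ => ?_
        simp only [Pi.add_apply, Pi.smul_apply, Pi.one_apply, smul_eq_mul]
        ring
      rw [this, hψ0]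
      ring
    have henergy : ∀ a b : ℝ, energy G l (a • (1 : V → ℝ) + b • ψ) = b ^ 2 * energy G l ψ := by
      intro a b
      simp only [energy, Finset.mul_sum]
      refine Finset.sum_congr rfl fun u _ => Finset.sum_congr rfl fun v _ => ?_
      simp only [Pi.add_apply, Pi.smul_apply, Pi.one_apply, smul_eq_mul]
      ring
    have happ : ∀ c, Fintype.linearCombination ℝ ![(1 : V → ℝ), ψ] c =
        c 0 • (1 : V → ℝ) + c 1 • ψ := fun c => by
      simp [Fintype.linearCombination_apply, Fin.sum_univ_two]
    refine h.le_of_energy_le hl hm ⟨1, h1⟩ (Fintype.linearCombination ℝ ![(1 : V → ℝ), ψ])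
      ?_ fun c => ?_
    · refine (injective_iff_map_eq_zero _).mpr fun c hc => ?_
      have h0 := hmass (c 0) (c 1)
      rw [← happ, hc] at h0
      have hz : mass G l (0 : V → ℝ) = 0 := by simp [mass]
      rw [hz] at h0
      have hc0 : c 0 = 0 := by
        by_contra hne
        have := sq_pos_of_ne_zero hne
        nlinarith [mul_pos this hone, mul_nonneg (sq_nonneg (c 1)) hpos.le]
      have hc1 : c 1 = 0 := by
        by_contra hne
        have := sq_pos_of_ne_zero hne
        nlinarith [mul_pos this hpos, mul_nonneg (sq_nonneg (c 0)) hone.le]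
      ext i
      fin_cases i
      · exact hc0
      · exact hc1
    · rw [happ, hmass, henergy, mul_add]
      have h2 : energy G l ψ / mass G l ψ * (c 1 ^ 2 * mass G l ψ) = c 1 ^ 2 * energy G l ψ := by
        field_simp
      rw [h2]
      have := energy_nonneg hl ψ
      have : 0 ≤ energy G l ψ / mass G l ψ * (c 0 ^ 2 * mass G l 1) := by positivity
      linarith
  obtain ⟨T, hT, hTE⟩ := h.exists_energy_le hl hm ⟨1, h1⟩
  let B : (V → ℝ) →ₗ[ℝ] ℝ := Fintype.linearCombination ℝ (m0 G l)
  have hker : LinearMap.ker (B ∘ₗ T) ≠ ⊥ := LinearMap.ker_ne_bot_of_finrank_lt (by simp)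
  obtain ⟨c, hc, hc0⟩ := (Submodule.ne_bot_iff _).mp hker
  have hTc : T c ≠ 0 := fun h0 => hc0 (hT (by rw [h0, map_zero]))
  have hTc0 : ∑ u, m0 G l u * T c u = 0 := by
    have : ∑ u, T c u • m0 G l u = 0 := LinearMap.mem_ker.mp hc
    simpa only [smul_eq_mul, mul_comm] using this
  have hupper : energy G l (T c) / mass G l (T c) ≤ μ ⟨1, h1⟩ :=
    (div_le_iff₀ (mass_pos hm hTc)).mpr (hTE c)
  refine IsLeast.csInf_eq ⟨⟨T c, hTc, hTc0, ?_⟩, ?_⟩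
  · exact le_antisymm (hlower _ hTc hTc0) hupper
  · rintro r ⟨ψ, hψ, hψ0, rfl⟩
    exact hlower ψ hψ hψ0

end MinMax

section AddLeaf

@[simp] lemma addLeaf_adj_some_some {V : Type*} (G : SimpleGraph V) (x u v : V) :
    (addLeaf G x).Adj (some u) (some v) ↔ G.Adj u v := by
  simp only [addLeaf, SimpleGraph.fromRel_adj]
  constructor
  · rintro ⟨-, (⟨a, b, ha, hb, h⟩ | ⟨-, h⟩) | (⟨a, b, ha, hb, h⟩ | ⟨-, h⟩)⟩ <;> simp_all
    exact h.symm
  · intro h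
    exact ⟨by simpa using h.ne, Or.inl (Or.inl ⟨u, v, rfl, rfl, h⟩)⟩

@[simp] lemma addLeaf_adj_some_none {V : Type*} (G : SimpleGraph V) (x u : V) :
    (addLeaf G x).Adj (some u) none ↔ u = x := by
  simp [addLeaf, SimpleGraph.fromRel_adj]

@[simp] lemma addLeaf_adj_none_some {V : Type*} (G : SimpleGraph V) (x u : V) :
    (addLeaf G x).Adj none (some u) ↔ u = x := by
  rw [SimpleGraph.adj_comm, addLeaf_adj_some_none]

variable (G : SimpleGraph V) (l : V → V → ℝ) (x : V) (t : ℝ)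

lemma m0_addLeaf_some (u : V) :
    m0 (addLeaf G x) (extLen l t) (some u) = m0 G l u + if u = x then t else 0 := by
  simp [m0, nbr, Finset.sum_filter, Fintype.sum_option, extLen, add_comm]

lemma m0_addLeaf_none : m0 (addLeaf G x) (extLen l t) none = t := by
  rw [m0, nbr, Finset.sum_filter, Fintype.sum_option]
  simp [extLen]

lemma mass_addLeaf (φ : Option V → ℝ) :
    mass (addLeaf G x) (extLen l t) φ =
      mass G l (φ ∘ some) + t * φ (some x) ^ 2 + t * φ none ^ 2 := by
  simp only [mass, Fintype.sum_option, m0_addLeaf_some, m0_addLeaf_none, add_mul,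
    Finset.sum_add_distrib, ite_mul, zero_mul, Function.comp_apply]
  simp
  ring

lemma energy_addLeaf (φ : Option V → ℝ) :
    energy (addLeaf G x) (extLen l t) φ =
      energy G l (φ ∘ some) + 1 / t * (φ (some x) - φ none) ^ 2 := by
  simp only [energy, nbr, Finset.sum_filter, Fintype.sum_option, addLeaf_adj_some_some,
    addLeaf_adj_some_none, addLeaf_adj_none_some, SimpleGraph.irrefl, extLen,
    Finset.sum_add_distrib, Function.comp_apply]
  simp
  ring

variable {G l x t}

lemma isLength_addLeaf {V : Type*} {G : SimpleGraph V} {l : V → V → ℝ} {x : V} {t : ℝ}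
    (hl : IsLength G l) (ht : 0 < t) :
    IsLength (addLeaf G x) (extLen l t) := by
  refine ⟨?_, ?_⟩
  · rintro (_ | u) (_ | v) <;> simp [extLen]
    exact hl.1 u v
  · rintro (_ | u) (_ | v) h <;> simp only [extLen] <;> try exact ht
    exact hl.2 u v (by simpa using h)

lemma m0_addLeaf_pos (hm : ∀ u, 0 < m0 G l u) (ht : 0 < t) (a : Option V) :
    0 < m0 (addLeaf G x) (extLen l t) a := by
  rcases a with _ | u
  · rwa [m0_addLeaf_none]
  · rw [m0_addLeaf_some]
    have := hm u
    split_ifs <;> linarith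

variable {μ : Fin (Fintype.card V) → ℝ} {ν : Fin (Fintype.card (Option V)) → ℝ}

/-- Adding a pendant edge does not increase the eigenvalues. -/
lemma addLeaf_eigenvalue_le (hl : IsLength G l) (hm : ∀ u, 0 < m0 G l u) (ht : 0 < t)
    (hμ : IsLapEigSeq G l μ) (hν : IsLapEigSeq (addLeaf G x) (extLen l t) ν)
    (k : Fin (Fintype.card V)) (hk : k.val < Fintype.card (Option V)) : ν ⟨k, hk⟩ ≤ μ k := by
  obtain ⟨T, hT, hTE⟩ := hμ.exists_energy_le hl hm k
  let ext : (V → ℝ) →ₗ[ℝ] (Option V → ℝ) := LinearMap.funLeft ℝ ℝ fun a : Option V => a.getD x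
  have hcomp : ∀ ψ : V → ℝ, ext ψ ∘ some = ψ := fun _ => rfl
  refine hν.le_of_energy_le (isLength_addLeaf hl ht) (m0_addLeaf_pos hm ht) ⟨k, hk⟩ (ext ∘ₗ T)
    ?_ fun c => ?_
  · intro c d hcd
    exact hT (by rw [← hcomp (T c), ← hcomp (T d)]; exact congrArg (· ∘ some) hcd)
  · rw [LinearMap.comp_apply, energy_addLeaf, mass_addLeaf, hcomp]
    have hx : ext (T c) (some x) - ext (T c) none = 0 := sub_self _
    rw [hx, zero_pow two_ne_zero, mul_zero, add_zero, add_assoc, mul_add]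
    have := hμ.nonneg hl hm k
    have : 0 ≤ μ k * (t * ext (T c) (some x) ^ 2 + t * ext (T c) none ^ 2) := by positivity
    linarith [hTE c]

/-- For a short pendant edge, the eigenvalues decrease at most by a factor close to one. -/
lemma le_addLeaf_eigenvalue (hl : IsLength G l) (hm : ∀ u, 0 < m0 G l u) (ht : 0 < t)
    (hμ : IsLapEigSeq G l μ) (hν : IsLapEigSeq (addLeaf G x) (extLen l t) ν)
    (k : Fin (Fintype.card V)) (hk : k.val < Fintype.card (Option V))
    (hsmall : 2 * t ^ 2 * μ k < 1) : μ k ≤ (1 + 3 * t / m0 G l x) * ν ⟨k, hk⟩ := by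
  have hl' := isLength_addLeaf (x := x) hl ht
  have hm' := m0_addLeaf_pos (x := x) hm ht
  have hle := addLeaf_eigenvalue_le hl hm ht hμ hν k hk
  have hν0 := hν.nonneg hl' hm' ⟨k, hk⟩
  obtain ⟨T, hT, hTE⟩ := hν.exists_energy_le hl' hm' ⟨k, hk⟩
  set r := ν ⟨k, hk⟩
  have hr : 0 < 1 / t - 2 * t * r := by
    rw [sub_pos, lt_div_iff₀ ht]
    nlinarith [mul_le_mul_of_nonneg_left hle (sq_nonneg t)]
  have key : ∀ c, energy G l (T c ∘ some) +
      (1 / t - 2 * t * r) * (T c (some x) - T c none) ^ 2 ≤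
      (1 + 3 * t / m0 G l x) * r * mass G l (T c ∘ some) := by
    intro c
    have h := hTE c
    rw [energy_addLeaf, mass_addLeaf] at h
    have hx : T c (some x) ^ 2 ≤ mass G l (T c ∘ some) / m0 G l x := by
      rw [le_div_iff₀ (hm x), mul_comm]
      exact Finset.single_le_sum (f := fun u => m0 G l u * (T c ∘ some) u ^ 2)
        (fun v _ => mul_nonneg (hm v).le (sq_nonneg _)) (Finset.mem_univ x)
    have hleaf : T c none ^ 2 ≤ 2 * T c (some x) ^ 2 + 2 * (T c (some x) - T c none) ^ 2 := by
      nlinarith [sq_nonneg (2 * T c (some x) - T c none)]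
    have hsum : t * T c (some x) ^ 2 + t * T c none ^ 2 ≤
        3 * t * (mass G l (T c ∘ some) / m0 G l x) +
          2 * t * (T c (some x) - T c none) ^ 2 := by
      nlinarith [mul_le_mul_of_nonneg_left hx ht.le, mul_le_mul_of_nonneg_left hleaf ht.le]
    have h2 := mul_le_mul_of_nonneg_left hsum hν0
    have h3 : (1 + 3 * t / m0 G l x) * r * mass G l (T c ∘ some) =
        r * mass G l (T c ∘ some) + r * (3 * t * (mass G l (T c ∘ some) / m0 G l x)) := by
      ring
    rw [h3]
    nlinarith
  refine hμ.le_of_energy_le hl hm k (LinearMap.funLeft ℝ ℝ some ∘ₗ T) ?_ fun c => ?_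
  · refine (injective_iff_map_eq_zero _).mpr fun c hc => hT ?_
    have hc' : T c ∘ some = 0 := hc
    have h := key c
    have hzero : mass G l (0 : V → ℝ) = 0 := by simp [mass]
    rw [hc', hzero, mul_zero] at h
    have hx : T c (some x) = 0 := congrFun hc' x
    have hn : T c none = 0 := by
      by_contra hne
      have := mul_pos hr (sq_pos_of_ne_zero hne)
      rw [hx, zero_sub, neg_sq] at h
      linarith [energy_nonneg hl (0 : V → ℝ)]
    rw [map_zero]
    funext a
    rcases a with _ | u
    · exact hn
    · exact congrFun hc' u
  · have := mul_nonneg hr.le (sq_nonneg (T c (some x) - T c none))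
    exact (le_add_of_nonneg_right this).trans (key c)

end AddLeaf

lemma IsLapEigSeq.m0_pos {G : SimpleGraph V} {l : V → V → ℝ}
    {μ : Fin (Fintype.card V) → ℝ} (hμ : IsLapEigSeq G l μ) (hconn : G.Connected)
    (hl : IsLength G l) : Nontrivial V ∧ ∀ u, 0 < m0 G l u := by
  obtain ⟨-, φ, -, ho⟩ := hμ
  have := hconn.nonempty
  have hnt : Nontrivial V := by
    by_contra hnt
    rw [not_nontrivial_iff_subsingleton] at hnt
    have hzero : ∀ u, m0 G l u = 0 := fun u => by
      refine Finset.sum_eq_zero fun v hv => ?_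
      have hadj : G.Adj u v := by simpa [nbr] using hv
      exact absurd (Subsingleton.elim u v) hadj.ne
    simpa [hzero] using ho ⟨0, Fintype.card_pos⟩ ⟨0, Fintype.card_pos⟩
  refine ⟨hnt, fun u => ?_⟩
  obtain ⟨v, hv⟩ := hconn.preconnected.exists_adj_of_nontrivial u
  exact Finset.sum_pos (fun w hw => hl.2 u w (by simpa [nbr] using hw)) ⟨v, by simpa [nbr] using hv⟩

/-- Let `0 = λ₀ < λ₁ ≤ ⋯ ≤ λ_{n−1}` be the eigenvalues of the Fujiwara Laplacian of
`(G, l)` and, for `t > 0`, let `0 = λ̃₀(t) < λ̃₁(t) ≤ ⋯ ≤ λ̃_n(t)` be those of `(G̃, l_t)`,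
where `G̃` adds a pendant vertex joined to `x` by an edge of length `t`. Then, as
`t → 0⁺`, `λ̃_k(t) → λ_k` for every `0 ≤ k ≤ n−1`; in particular
`λ₁(G̃, l_t) → λ₁(G, l)`. -/
theorem addLeaf_eigenvalues_tendsto {V : Type*} [Fintype V]
    (G : SimpleGraph V) (hconn : G.Connected) (l : V → V → ℝ) (hl : IsLength G l) (x : V)
    (μ : Fin (Fintype.card V) → ℝ) (hμ : IsLapEigSeq G l μ)
    (μ' : ℝ → Fin (Fintype.card (Option V)) → ℝ)
    (hμ' : ∀ t : ℝ, 0 < t → IsLapEigSeq (addLeaf G x) (extLen l t) (μ' t)) :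
    (∀ k : Fin (Fintype.card V),
      Filter.Tendsto
        (fun t : ℝ => μ' t ⟨k.val, by rw [Fintype.card_option]; exact k.isLt.trans (Nat.lt_succ_self _)⟩)
        (nhdsWithin 0 (Set.Ioi 0)) (nhds (μ k))) ∧
    Filter.Tendsto (fun t : ℝ => lambda1 (addLeaf G x) (extLen l t))
      (nhdsWithin 0 (Set.Ioi 0)) (nhds (lambda1 G l)) := by
  obtain ⟨hnt, hm⟩ := hμ.m0_pos hconn hl
  have hlim : ∀ k : Fin (Fintype.card V), Filter.Tendsto
      (fun t : ℝ => μ' t ⟨k.val, by rw [Fintype.card_option]; exact k.isLt.trans (Nat.lt_succ_self _)⟩)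
      (nhdsWithin 0 (Set.Ioi 0)) (nhds (μ k)) := by
    intro k
    have hlow : Filter.Tendsto (fun t : ℝ => μ k / (1 + 3 * t / m0 G l x))
        (nhdsWithin 0 (Set.Ioi 0)) (nhds (μ k)) := by
      have hc : ContinuousAt (fun t : ℝ => μ k / (1 + 3 * t / m0 G l x)) 0 :=
        ContinuousAt.div (by fun_prop) (by fun_prop) (by simp)
      simpa [ContinuousAt] using hc.tendsto.mono_left nhdsWithin_le_nhds
    have hsmall : ∀ᶠ t : ℝ in nhdsWithin 0 (Set.Ioi 0), 2 * t ^ 2 * μ k < 1 := by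
      have hc : ContinuousAt (fun t : ℝ => 2 * t ^ 2 * μ k) 0 := by fun_prop
      exact (hc.eventually_lt_const (by simp)).filter_mono nhdsWithin_le_nhds
    refine tendsto_of_tendsto_of_tendsto_of_le_of_le' hlow tendsto_const_nhds ?_ ?_
    · filter_upwards [hsmall, self_mem_nhdsWithin] with t hts ht
      have ht' : 0 < t := ht
      have hmx := hm x
      rw [div_le_iff₀' (by positivity)]
      exact le_addLeaf_eigenvalue hl hm ht hμ (hμ' t ht) k _ hts
    · filter_upwards [self_mem_nhdsWithin] with t ht
      exact addLeaf_eigenvalue_le hl hm ht hμ (hμ' t ht) k _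
  refine ⟨hlim, ?_⟩
  have h1 : 1 < Fintype.card V := Fintype.one_lt_card
  rw [hμ.lambda1_eq hl hm h1]
  refine (hlim ⟨1, h1⟩).congr' ?_
  filter_upwards [self_mem_nhdsWithin] with t ht
  exact ((hμ' t ht).lambda1_eq (isLength_addLeaf hl ht) (m0_addLeaf_pos hm ht) _).symm

end
end

section
/- Under the stated hypotheses on the family Ã(t), there exist constants C > 0 and ε′ ∈ (0, ε] such that for all t ∈ (0, ε′) and all k with 1 ≤ k ≤ n−1, the eigenvalue λ̃_k(t) of Ã(t) satisfies λ̃_k(t) ≤ λ_k + Ct. -/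
open Filter Topology

noncomputable section

/-- `μ` is the nondecreasing sequence of eigenvalues, counted with multiplicity, of the
real symmetric matrix `M`: it is monotone and admits a corresponding family of
eigenvectors that is orthonormal for the Euclidean inner product. -/
def IsEigSeq {m : ℕ} (M : Matrix (Fin m) (Fin m) ℝ) (μ : Fin m → ℝ) : Prop :=
  Monotone μ ∧ ∃ v : Fin m → (Fin m → ℝ),
    (∀ i, M.mulVec (v i) = fun j => μ i * v i j) ∧
    (∀ i j, (∑ k, v i k * v j k) = if i = j then 1 else 0)

open Matrix in
/-- An eigenvalue sequence diagonalizes the quadratic form in orthonormal coordinates. -/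
theorem IsEigSeq.exists_coordinates {p : ℕ} {M : Matrix (Fin p) (Fin p) ℝ} {μ : Fin p → ℝ}
    (h : IsEigSeq M μ) :
    ∃ V : Matrix (Fin p) (Fin p) ℝ, ∀ x : Fin p → ℝ,
      x ⬝ᵥ M *ᵥ x = ∑ i, μ i * (V *ᵥ x) i ^ 2 ∧ x ⬝ᵥ x = ∑ i, (V *ᵥ x) i ^ 2 := by
  obtain ⟨-, v, hv, ho⟩ := h
  set V : Matrix (Fin p) (Fin p) ℝ := Matrix.of v with hV
  have hVV : V * Vᵀ = 1 := by
    ext i j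
    simp [Matrix.mul_apply, Matrix.one_apply, hV, ho]
  have hVV' : Vᵀ * V = 1 := mul_eq_one_comm.mp hVV
  have hMV : M * Vᵀ = Vᵀ * Matrix.diagonal μ := by
    ext i j
    have := congrFun (hv j) i
    simp only [Matrix.mulVec, dotProduct] at this
    rw [Matrix.mul_diagonal]
    simp [Matrix.mul_apply, hV, this, mul_comm]
  have hM : M = Vᵀ * Matrix.diagonal μ * V := by
    rw [← hMV, Matrix.mul_assoc, hVV', Matrix.mul_one]
  refine ⟨V, fun x => ⟨?_, ?_⟩⟩
  · have : x ⬝ᵥ M *ᵥ x = (V *ᵥ x) ⬝ᵥ (Matrix.diagonal μ *ᵥ (V *ᵥ x)) := by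
      conv_lhs => rw [hM]
      rw [← Matrix.mulVec_mulVec, ← Matrix.mulVec_mulVec, Matrix.dotProduct_mulVec,
        Matrix.vecMul_transpose]
    rw [this]
    simp only [dotProduct, Matrix.mulVec_diagonal]
    exact Finset.sum_congr rfl fun i _ => by ring
  · have : x ⬝ᵥ x = (V *ᵥ x) ⬝ᵥ (V *ᵥ x) := by
      conv_rhs => rw [← Matrix.vecMul_transpose, ← Matrix.dotProduct_mulVec,
        Matrix.vecMul_transpose, Matrix.mulVec_mulVec, hVV', Matrix.one_mulVec]
    rw [this]
    simp only [dotProduct]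
    exact Finset.sum_congr rfl fun i _ => by ring

open Matrix in
/-- Comparison of eigenvalues through an injective linear map of trial vectors. -/
theorem IsEigSeq.le_of_trial_map {p q : ℕ} {M : Matrix (Fin p) (Fin p) ℝ}
    {N : Matrix (Fin q) (Fin q) ℝ} {μ : Fin p → ℝ} {ν : Fin q → ℝ}
    (hM : IsEigSeq M μ) (hN : IsEigSeq N ν)
    (L : (Fin p → ℝ) →ₗ[ℝ] (Fin q → ℝ)) (hL : Function.Injective L)
    (i : Fin p) (j : Fin q) (hij : (j : ℕ) ≤ i) (c : ℝ)
    (hc : ∀ x, x ⬝ᵥ M *ᵥ x ≤ μ i * (x ⬝ᵥ x) → L x ⬝ᵥ N *ᵥ L x ≤ c * (L x ⬝ᵥ L x)) :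
    ν j ≤ c := by
  obtain ⟨V, hV⟩ := hM.exists_coordinates
  obtain ⟨W, hW⟩ := hN.exists_coordinates
  let F : (Fin p → ℝ) →ₗ[ℝ] ({a // i < a} ⊕ {b // b < j} → ℝ) :=
    LinearMap.pi (Sum.elim
      (fun a => LinearMap.proj a.1 ∘ₗ V.mulVecLin)
      (fun b => LinearMap.proj b.1 ∘ₗ W.mulVecLin ∘ₗ L))
  have hF : LinearMap.ker F ≠ ⊥ := by
    apply LinearMap.ker_ne_bot_of_finrank_lt
    have hi := i.2
    have c1 : Fintype.card {a // i < a} = p - 1 - i := by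
      rw [Fintype.card_subtype, Finset.filter_lt_eq_Ioi, Fin.card_Ioi]
    have c2 : Fintype.card {b // b < j} = j := by
      rw [Fintype.card_subtype, Finset.filter_gt_eq_Iio, Fin.card_Iio]
    rw [Module.finrank_fintype_fun_eq_card, Module.finrank_fintype_fun_eq_card,
      Fintype.card_sum, c1, c2, Fintype.card_fin]
    omega
  obtain ⟨x, hx, hx0⟩ := (Submodule.ne_bot_iff _).mp hF
  rw [LinearMap.mem_ker] at hx
  have hVx : ∀ a, i < a → (V *ᵥ x) a = 0 := fun a ha => congrFun hx (Sum.inl ⟨a, ha⟩)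
  have hWx : ∀ b, b < j → (W *ᵥ L x) b = 0 := fun b hb => congrFun hx (Sum.inr ⟨b, hb⟩)
  have hupper : x ⬝ᵥ M *ᵥ x ≤ μ i * (x ⬝ᵥ x) := by
    rw [(hV x).1, (hV x).2, Finset.mul_sum]
    refine Finset.sum_le_sum fun a _ => ?_
    rcases lt_or_ge i a with ha | ha
    · simp [hVx a ha]
    · exact mul_le_mul_of_nonneg_right (hM.1 ha) (sq_nonneg _)
  have hlower : ν j * (L x ⬝ᵥ L x) ≤ L x ⬝ᵥ N *ᵥ L x := by
    rw [(hW _).1, (hW _).2, Finset.mul_sum]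
    refine Finset.sum_le_sum fun b _ => ?_
    rcases lt_or_ge b j with hb | hb
    · simp [hWx b hb]
    · exact mul_le_mul_of_nonneg_right (hN.1 hb) (sq_nonneg _)
  have hLx : L x ≠ 0 := fun h => hx0 (hL (by rw [h, map_zero]))
  have hpos : 0 < L x ⬝ᵥ L x :=
    lt_of_le_of_ne (Finset.sum_nonneg fun a _ => mul_self_nonneg _)
      (fun h => hLx (dotProduct_self_eq_zero.mp h.symm))
  exact le_of_mul_le_mul_right (hlower.trans (hc x hupper)) hpos

/-- Extend a vector by `s` times its last coordinate. -/
def snocLast (m : ℕ) (s : ℝ) : (Fin (m + 1) → ℝ) →ₗ[ℝ] (Fin (m + 2) → ℝ) where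
  toFun x := Fin.snoc (α := fun _ => ℝ) x (s * x (Fin.last m))
  map_add' x y := by
    ext i
    refine Fin.lastCases ?_ (fun i => ?_) i <;> simp [mul_add]
  map_smul' c x := by
    ext i
    refine Fin.lastCases ?_ (fun i => ?_) i <;> simp [mul_left_comm]

@[simp]
theorem snocLast_castSucc (m : ℕ) (s : ℝ) (x : Fin (m + 1) → ℝ) (i : Fin (m + 1)) :
    snocLast m s x i.castSucc = x i := by
  simp [snocLast]

@[simp]
theorem snocLast_last (m : ℕ) (s : ℝ) (x : Fin (m + 1) → ℝ) :
    snocLast m s x (Fin.last (m + 1)) = s * x (Fin.last m) := by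
  simp [snocLast]

theorem snocLast_injective (m : ℕ) (s : ℝ) : Function.Injective (snocLast m s) := by
  intro x y h
  ext i
  simpa using congrFun h i.castSucc

open Matrix in
theorem snocLast_dotProduct_self (m : ℕ) (s : ℝ) (x : Fin (m + 1) → ℝ) :
    snocLast m s x ⬝ᵥ snocLast m s x = x ⬝ᵥ x + s ^ 2 * x (Fin.last m) ^ 2 := by
  simp only [dotProduct, Fin.sum_univ_castSucc (n := m + 1), snocLast_castSucc, snocLast_last]
  ring

open Matrix in
theorem snocLast_quadratic (m : ℕ) (s : ℝ) (x : Fin (m + 1) → ℝ)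
    (B : Matrix (Fin (m + 2)) (Fin (m + 2)) ℝ) (hB : B.IsSymm)
    (h0 : ∀ i : Fin (m + 1), i ≠ Fin.last m → B i.castSucc (Fin.last (m + 1)) = 0) :
    snocLast m s x ⬝ᵥ B *ᵥ snocLast m s x =
      (∑ i, ∑ j, B (Fin.castSucc i) (Fin.castSucc j) * (x i * x j)) +
      (2 * s * B (Fin.last m).castSucc (Fin.last (m + 1)) +
        s ^ 2 * B (Fin.last (m + 1)) (Fin.last (m + 1))) * x (Fin.last m) ^ 2 := by
  have hcol : ∑ i, x i * B (Fin.castSucc i) (Fin.last (m + 1)) =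
      x (Fin.last m) * B (Fin.last m).castSucc (Fin.last (m + 1)) :=
    Finset.sum_eq_single _ (fun i _ hi => by rw [h0 i hi, mul_zero]) (by simp)
  have hrow : ∑ i, B (Fin.last (m + 1)) (Fin.castSucc i) * x i =
      x (Fin.last m) * B (Fin.last m).castSucc (Fin.last (m + 1)) := by
    rw [← hcol]
    exact Finset.sum_congr rfl fun i _ => by rw [hB.apply]; ring
  have hsplit : ∀ i, x i * (∑ j, B (Fin.castSucc i) (Fin.castSucc j) * x j +
      B (Fin.castSucc i) (Fin.last (m + 1)) * (s * x (Fin.last m))) =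
      ∑ j, B (Fin.castSucc i) (Fin.castSucc j) * (x i * x j) +
      x i * B (Fin.castSucc i) (Fin.last (m + 1)) * (s * x (Fin.last m)) := by
    intro i
    rw [mul_add, Finset.mul_sum]
    congr 1
    · exact Finset.sum_congr rfl fun j _ => by ring
    · ring
  simp only [dotProduct, Matrix.mulVec, Fin.sum_univ_castSucc (n := m + 1), snocLast_castSucc,
    snocLast_last]
  rw [hrow, Finset.sum_congr rfl fun i _ => hsplit i, Finset.sum_add_distrib,
    ← Finset.sum_mul, hcol]
  ring

/-- A bilinear form with entries bounded by `c` is bounded by `c` times the dimension. -/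
theorem sum_sum_mul_le_of_abs_le {p : ℕ} (D : Fin p → Fin p → ℝ) (c : ℝ)
    (hD : ∀ i j, |D i j| ≤ c) (x : Fin p → ℝ) :
    ∑ i, ∑ j, D i j * (x i * x j) ≤ c * p * (x ⬝ᵥ x) := by
  have hterm : ∀ i j, D i j * (x i * x j) ≤ c / 2 * (x i * x i) + c / 2 * (x j * x j) := by
    intro i j
    have h := abs_le.mp (hD i j)
    nlinarith [mul_nonneg (sub_nonneg.mpr h.2) (sq_nonneg (x i + x j)),
      mul_nonneg (neg_le_iff_add_nonneg.mp h.1) (sq_nonneg (x i - x j))]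
  calc ∑ i, ∑ j, D i j * (x i * x j)
      ≤ ∑ i, ∑ j, (c / 2 * (x i * x i) + c / 2 * (x j * x j)) :=
        Finset.sum_le_sum fun i _ => Finset.sum_le_sum fun j _ => hterm i j
    _ = c * p * (x ⬝ᵥ x) := by
        simp only [Finset.sum_add_distrib, Finset.sum_const, ← Finset.mul_sum, dotProduct,
          Finset.card_univ, Fintype.card_fin, nsmul_eq_mul]
        ring

/-- The leading coefficient of the off-diagonal coupling, in terms of square roots. -/
theorem coupling_leading_term {α t : ℝ} (hα : 0 < α) (ht : 0 < t) (htα : t ≤ 2 * α) :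
    ∃ β : ℝ, β = (1 / (Real.sqrt α * t ^ ((3 : ℝ) / 2))) * (1 - t / (2 * α)) ∧ 0 ≤ β ∧
      β * t ^ 2 ≤ Real.sqrt t / Real.sqrt α ∧
      (1 / (α * t)) * (1 - t / α) ≤ β ^ 2 * t ^ 2 := by
  have hq : 0 < Real.sqrt α := Real.sqrt_pos.mpr hα
  have hr : 0 < Real.sqrt t := Real.sqrt_pos.mpr ht
  have hpow : t ^ ((3 : ℝ) / 2) = Real.sqrt t ^ 3 := by
    rw [Real.sqrt_eq_rpow, ← Real.rpow_natCast, ← Real.rpow_mul ht.le]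
    norm_num
  have hfac : 0 ≤ 1 - t / (2 * α) := sub_nonneg.mpr ((div_le_one (by positivity)).mpr htα)
  have hfac1 : 1 - t / (2 * α) ≤ 1 := sub_le_self _ (by positivity)
  have hα2 : Real.sqrt α ^ 2 = α := Real.sq_sqrt hα.le
  have ht2 : Real.sqrt t ^ 2 = t := Real.sq_sqrt ht.le
  refine ⟨_, rfl, by positivity, ?_, ?_⟩
  · have h : (1 / (Real.sqrt α * t ^ ((3 : ℝ) / 2))) * (1 - t / (2 * α)) * t ^ 2 =
        Real.sqrt t / Real.sqrt α * (1 - t / (2 * α)) := by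
      have ht4 : t ^ 2 = Real.sqrt t ^ 4 := by rw [← ht2]; simp only [Real.sqrt_sq hr.le]; ring
      rw [hpow, ht4]
      field_simp
    rw [h]
    exact mul_le_of_le_one_right (by positivity) hfac1
  · have h : ((1 / (Real.sqrt α * t ^ ((3 : ℝ) / 2))) * (1 - t / (2 * α))) ^ 2 * t ^ 2 =
        (1 / (α * t)) * (1 - t / (2 * α)) ^ 2 := by
      have hsq : (Real.sqrt α * Real.sqrt t ^ 3) ^ 2 = α * t ^ 3 := by
        rw [mul_pow, hα2, ← pow_mul, mul_comm 3 2, pow_mul, ht2]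
      rw [hpow, mul_pow, div_pow, hsq]
      field_simp
    rw [h]
    have hle : 1 - t / α ≤ (1 - t / (2 * α)) ^ 2 := by
      have : t / α = 2 * (t / (2 * α)) := by field_simp
      nlinarith [sq_nonneg (t / (2 * α))]
    exact mul_le_mul_of_nonneg_left hle (by positivity)

/-- The Schur complement removes the singular part of the last diagonal entry up to `O(t)`. -/
theorem singular_part_sub_schur_le {α K t b : ℝ} (hα : 0 < α) (hK : 0 < K) (ht : 0 < t)
    (htα : t ≤ 2 * α)
    (hb : |b + (1 / (Real.sqrt α * t ^ ((3 : ℝ) / 2))) * (1 - t / (2 * α))| ≤ K * Real.sqrt t) :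
    (1 / (α * t)) * (1 - t / α) - b ^ 2 * t ^ 2 ≤ 2 * K / Real.sqrt α * t := by
  obtain ⟨β, hβ, hβ0, hβt, hsing⟩ := coupling_leading_term hα ht htα
  rw [← hβ] at hb
  have hupper := (abs_le.mp hb).2
  have hr : 0 < Real.sqrt t := Real.sqrt_pos.mpr ht
  have hsq : β ^ 2 - b ^ 2 ≤ 2 * β * (K * Real.sqrt t) := by
    nlinarith [sq_nonneg (b + β), mul_le_mul_of_nonneg_left hupper hβ0]
  calc (1 / (α * t)) * (1 - t / α) - b ^ 2 * t ^ 2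
      ≤ (β ^ 2 - b ^ 2) * t ^ 2 := by linarith
    _ ≤ 2 * β * (K * Real.sqrt t) * t ^ 2 := mul_le_mul_of_nonneg_right hsq (sq_nonneg t)
    _ = 2 * K * Real.sqrt t * (β * t ^ 2) := by ring
    _ ≤ 2 * K * Real.sqrt t * (Real.sqrt t / Real.sqrt α) :=
        mul_le_mul_of_nonneg_left hβt (by positivity)
    _ = 2 * K / Real.sqrt α * (Real.sqrt t * Real.sqrt t) := by ring
    _ = 2 * K / Real.sqrt α * t := by rw [Real.mul_self_sqrt ht.le]

/-- The off-diagonal coupling has size `O(t ^ (-3/2))`. -/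
theorem coupling_sq_le {α K t b : ℝ} (hα : 0 < α) (hK : 0 < K) (ht : 0 < t)
    (ht1 : t ≤ 1) (htα : t ≤ 2 * α)
    (hb : |b + (1 / (Real.sqrt α * t ^ ((3 : ℝ) / 2))) * (1 - t / (2 * α))| ≤ K * Real.sqrt t) :
    (b * t ^ 2) ^ 2 ≤ (1 / Real.sqrt α + K) ^ 2 * t := by
  obtain ⟨β, hβ, hβ0, hβt, -⟩ := coupling_leading_term hα ht htα
  rw [← hβ] at hb
  have hr : 0 < Real.sqrt t := Real.sqrt_pos.mpr ht
  have habs : |b| ≤ β + K * Real.sqrt t := by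
    rw [abs_le] at hb ⊢
    constructor <;> linarith
  have hbound : |b * t ^ 2| ≤ (1 / Real.sqrt α + K) * Real.sqrt t := by
    rw [abs_mul, abs_of_nonneg (sq_nonneg t)]
    calc |b| * t ^ 2 ≤ (β + K * Real.sqrt t) * t ^ 2 :=
          mul_le_mul_of_nonneg_right habs (sq_nonneg t)
      _ = β * t ^ 2 + K * Real.sqrt t * t ^ 2 := by ring
      _ ≤ Real.sqrt t / Real.sqrt α + K * Real.sqrt t * 1 :=
          add_le_add hβt (mul_le_mul_of_nonneg_left (pow_le_one₀ ht.le ht1) (by positivity))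
      _ = (1 / Real.sqrt α + K) * Real.sqrt t := by ring
  calc (b * t ^ 2) ^ 2 = |b * t ^ 2| ^ 2 := (sq_abs _).symm
    _ ≤ ((1 / Real.sqrt α + K) * Real.sqrt t) ^ 2 := pow_le_pow_left₀ (abs_nonneg _) hbound 2
    _ = (1 / Real.sqrt α + K) ^ 2 * t := by rw [mul_pow, Real.sq_sqrt ht.le]

/-- Under the hypotheses on the family `Ã(t)`, there exist `C > 0` and `ε′ ∈ (0, ε]`
such that for all `t ∈ (0, ε′)` and all `k` with `1 ≤ k ≤ n−1`, the eigenvalue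
`λ̃_k(t)` of `Ã(t)` satisfies `λ̃_k(t) ≤ λ_k + Ct`. -/
theorem eigenvalues_upper_bound_of_perturbation (m : ℕ)
    (A : Matrix (Fin (m + 1)) (Fin (m + 1)) ℝ) (hA : A.IsSymm)
    (lam : Fin (m + 1) → ℝ) (hlam : IsEigSeq A lam)
    (α ε K : ℝ) (hα : 0 < α) (hε : 0 < ε) (hK : 0 < K)
    (At : ℝ → Matrix (Fin (m + 2)) (Fin (m + 2)) ℝ)
    (hAtSymm : ∀ t ∈ Set.Ioo (0 : ℝ) ε, (At t).IsSymm)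
    (h1 : ∀ t ∈ Set.Ioo (0 : ℝ) ε, ∀ i j : Fin (m + 1),
      ¬(i = Fin.last m ∧ j = Fin.last m) →
      |At t i.castSucc j.castSucc - A i j| ≤ K * t)
    (h2 : ∀ t ∈ Set.Ioo (0 : ℝ) ε,
      |At t (Fin.last m).castSucc (Fin.last m).castSucc - A (Fin.last m) (Fin.last m)
        - (1 / (α * t)) * (1 - t / α)| ≤ K * t)
    (h3 : ∀ t ∈ Set.Ioo (0 : ℝ) ε,
      |At t (Fin.last m).castSucc (Fin.last (m + 1))
        + (1 / (Real.sqrt α * t ^ ((3 : ℝ) / 2))) * (1 - t / (2 * α))| ≤ K * Real.sqrt t)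
    (h4 : ∀ t ∈ Set.Ioo (0 : ℝ) ε, ∀ i : Fin (m + 1), i ≠ Fin.last m →
      At t i.castSucc (Fin.last (m + 1)) = 0)
    (h5 : ∀ t ∈ Set.Ioo (0 : ℝ) ε, At t (Fin.last (m + 1)) (Fin.last (m + 1)) = (t ^ 2)⁻¹)
    (lamt : ℝ → Fin (m + 2) → ℝ)
    (hlamt : ∀ t ∈ Set.Ioo (0 : ℝ) ε, IsEigSeq (At t) (lamt t)) :
    ∃ C > (0 : ℝ), ∃ ε' : ℝ, 0 < ε' ∧ ε' ≤ ε ∧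
      ∀ t ∈ Set.Ioo (0 : ℝ) ε', ∀ k : Fin (m + 1), 1 ≤ (k : ℕ) →
        lamt t k.castSucc ≤ lam k + C * t := by
  set Λ : ℝ := ∑ i, |lam i| with hΛ
  have hΛ0 : 0 ≤ Λ := Finset.sum_nonneg fun i _ => abs_nonneg _
  set G : ℝ := (1 / Real.sqrt α + K) ^ 2 with hG
  have hG0 : 0 ≤ G := sq_nonneg _
  have hq : 0 < Real.sqrt α := Real.sqrt_pos.mpr hα
  set H : ℝ := 2 * K / Real.sqrt α with hH
  have hH0 : 0 < H := by positivity
  set P : ℝ := K * ((m + 1 : ℕ) : ℝ) with hP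
  have hP0 : 0 < P := by positivity
  refine ⟨P + H + Λ * G, by positivity, min ε (min 1 (2 * α)), by positivity,
    min_le_left _ _, ?_⟩
  intro t ht k _
  obtain ⟨ht0, ht'⟩ := ht
  obtain ⟨htε, hts⟩ := lt_min_iff.mp ht'
  obtain ⟨ht1, htα⟩ := lt_min_iff.mp hts
  have htm : t ∈ Set.Ioo (0 : ℝ) ε := ⟨ht0, htε⟩
  set b : ℝ := At t (Fin.last m).castSucc (Fin.last (m + 1)) with hb
  have hschur := singular_part_sub_schur_le hα hK ht0 htα.le (h3 t htm)
  have hcoup := coupling_sq_le hα hK ht0 ht1.le htα.le (h3 t htm)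
  rw [← hb, ← hH] at hschur
  rw [← hb, ← hG] at hcoup
  set E : ℝ := (1 / (α * t)) * (1 - t / α)
  refine hlam.le_of_trial_map (hlamt t htm) (snocLast m (-(b * t ^ 2)))
    (snocLast_injective _ _) k k.castSucc le_rfl _ fun x hx => ?_
  rw [snocLast_quadratic _ _ _ _ (hAtSymm t htm) (h4 t htm), snocLast_dotProduct_self,
    h5 t htm, ← hb]
  have hcoef : 2 * -(b * t ^ 2) * b + (-(b * t ^ 2)) ^ 2 * (t ^ 2)⁻¹ = -(b ^ 2 * t ^ 2) := by
    field_simp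
    ring
  rw [hcoef, neg_sq]
  have hD := sum_sum_mul_le_of_abs_le
    (fun i j => At t (Fin.castSucc i) (Fin.castSucc j) - A i j -
      if i = Fin.last m ∧ j = Fin.last m then E else 0) (K * t)
    (fun i j => by
      by_cases h : i = Fin.last m ∧ j = Fin.last m
      · obtain ⟨rfl, rfl⟩ := h
        rw [if_pos ⟨rfl, rfl⟩]
        exact h2 t htm
      · simpa [h] using h1 t htm i j h) x
  have hsum : ∑ i, ∑ j, (At t (Fin.castSucc i) (Fin.castSucc j) - A i j -
      if i = Fin.last m ∧ j = Fin.last m then E else 0) * (x i * x j) =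
      ∑ i, ∑ j, At t (Fin.castSucc i) (Fin.castSucc j) * (x i * x j) - x ⬝ᵥ A.mulVec x -
      E * x (Fin.last m) ^ 2 := by
    have hquad : x ⬝ᵥ A.mulVec x = ∑ i, ∑ j, A i j * (x i * x j) := by
      simp only [dotProduct, Matrix.mulVec, Finset.mul_sum]
      exact Finset.sum_congr rfl fun i _ => Finset.sum_congr rfl fun j _ => by ring
    have hsingle : ∑ i, ∑ j, (if i = Fin.last m ∧ j = Fin.last m then E else 0) * (x i * x j) =
        E * x (Fin.last m) ^ 2 := by
      simp [ite_and, sq]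
    simp only [sub_mul, Finset.sum_sub_distrib, hquad, hsingle]
  rw [hsum] at hD
  have hlast : x (Fin.last m) ^ 2 ≤ x ⬝ᵥ x := by
    rw [sq]
    exact Finset.single_le_sum (f := fun i => x i * x i) (fun i _ => mul_self_nonneg _)
      (Finset.mem_univ _)
  have hk : |lam k| ≤ Λ :=
    Finset.single_le_sum (f := fun i => |lam i|) (fun i _ => abs_nonneg _) (Finset.mem_univ _)
  set X : ℝ := x ⬝ᵥ x
  set z : ℝ := x (Fin.last m) ^ 2
  have hz0 : 0 ≤ z := sq_nonneg _
  set S : ℝ := (b * t ^ 2) ^ 2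
  have hS0 : 0 ≤ S := sq_nonneg _
  have hX0 : 0 ≤ X := hz0.trans hlast
  have e1 : (E - b ^ 2 * t ^ 2) * z ≤ H * t * X :=
    mul_le_mul hschur hlast hz0 (by positivity)
  have e2 : -(lam k) * (S * z) ≤ Λ * (G * t * X) :=
    mul_le_mul ((neg_le_abs _).trans hk) (mul_le_mul hcoup hlast hz0 (by positivity))
      (by positivity) hΛ0
  have e3 : 0 ≤ (P + H + Λ * G) * t * (S * z) := by positivity
  have e4 : K * t * ((m + 1 : ℕ) : ℝ) * X = P * t * X := by rw [hP]; ring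
  rw [e4] at hD
  linarith

end
end
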